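/- arXiv:2407.10951 — 4 statements merged into one kernel-verified Lean document; each statement's English description precedes it below -/
import Mathlib

section
/- Let N ≥ 1 and h ≥ 1 be integers. Then ∑_{τ} φ(gcd(τ, N/τ)) ≤ h · 2^{ω(N)}, where the sum runs over all positive divisors τ of N such that gcd(τ, N/τ) divides h. -/
theorem card_divisors_filter_gcd_eq_le (N d : ℕ) :
    (N.divisors.filter (fun τ => Nat.gcd τ (N / τ) = d)).card ≤ 2 ^ N.primeFactors.card := by
  rw [← Finset.card_powerset]
  have factorization_eq_or : ∀ τ ∈ N.divisors.filter (fun τ => Nat.gcd τ (N / τ) = d), ∀ p,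
      τ.factorization p ≤ N.factorization p ∧
      (τ.factorization p = d.factorization p ∨
        N.factorization p - τ.factorization p = d.factorization p) := by
    intro τ hτ p
    simp only [Finset.mem_filter, Nat.mem_divisors] at hτ
    obtain ⟨⟨hdvd, hN⟩, rfl⟩ := hτ
    have hτ0 : τ ≠ 0 := ne_zero_of_dvd_ne_zero hN hdvd
    have hq0 : N / τ ≠ 0 := (Nat.div_pos (Nat.le_of_dvd hN.bot_lt hdvd) hτ0.bot_lt).ne'
    have hle : τ.factorization p ≤ N.factorization p :=
      (Nat.factorization_le_iff_dvd hτ0 hN).2 hdvd p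
    rw [Nat.factorization_gcd hτ0 hq0, Nat.factorization_div hdvd, Finsupp.inf_apply,
      Finsupp.tsub_apply]
    omega
  refine Finset.card_le_card_of_injOn
    (fun τ => N.primeFactors.filter (fun p => τ.factorization p = d.factorization p))
    (fun τ _ => Finset.mem_coe.2 (Finset.mem_powerset.2 (Finset.filter_subset _ _))) ?_
  intro σ hσ τ hτ hστ
  rw [Finset.mem_coe] at hσ hτ
  have ne_zero : ∀ τ ∈ N.divisors.filter (fun τ => Nat.gcd τ (N / τ) = d), τ ≠ 0 :=
    fun τ h => (Nat.pos_of_mem_divisors (Finset.mem_filter.1 h).1).ne'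
  refine Nat.eq_of_factorization_eq (ne_zero σ hσ) (ne_zero τ hτ) fun p => ?_
  obtain ⟨hσN, hσd⟩ := factorization_eq_or σ hσ p
  obtain ⟨hτN, hτd⟩ := factorization_eq_or τ hτ p
  by_cases hp : p ∈ N.primeFactors
  · have hiff : σ.factorization p = d.factorization p ↔ τ.factorization p = d.factorization p := by
      simpa [Finset.mem_filter, hp] using Finset.ext_iff.1 hστ p
    omega
  · have hNp : N.factorization p = 0 := by
      rwa [← Finsupp.notMem_support_iff, Nat.support_factorization]
    omega

/-- The sum of `φ(gcd(τ, N/τ))` over the positive divisors `τ` of `N` with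
`gcd(τ, N/τ) ∣ h` is at most `h · 2^{ω(N)}`. -/
theorem sum_totient_gcd_dvd_le (N h : ℕ) (hN : 1 ≤ N) (hh : 1 ≤ h) :
    ∑ τ ∈ N.divisors.filter (fun τ => Nat.gcd τ (N / τ) ∣ h),
        Nat.totient (Nat.gcd τ (N / τ)) ≤ h * 2 ^ N.primeFactors.card := by
  have hmaps : ∀ τ ∈ N.divisors.filter (fun τ => Nat.gcd τ (N / τ) ∣ h),
      Nat.gcd τ (N / τ) ∈ h.divisors := fun τ hτ =>
    Nat.mem_divisors.2 ⟨(Finset.mem_filter.1 hτ).2, by omega⟩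
  rw [← Finset.sum_fiberwise_of_maps_to hmaps]
  calc _ ≤ ∑ d ∈ h.divisors, d.totient * 2 ^ N.primeFactors.card := by
        refine Finset.sum_le_sum fun d _ => ?_
        rw [Finset.sum_congr rfl fun τ hτ =>
          congrArg Nat.totient (Finset.mem_filter.1 hτ).2, Finset.sum_const, smul_eq_mul, mul_comm]
        refine Nat.mul_le_mul_left _ (le_trans (Finset.card_le_card ?_)
          (card_divisors_filter_gcd_eq_le N d))
        exact Finset.filter_subset_filter _ (Finset.filter_subset _ _)
    _ = h * 2 ^ N.primeFactors.card := by rw [← Finset.sum_mul, Nat.sum_totient]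
end

section
/- Let N ≥ 1 be an integer. Then ∑_{τ | N} φ(gcd(τ, N/τ)) ≤ √N · 2^{ω(N)}, where the sum runs over all positive divisors τ of N. -/
open scoped Nat

namespace Nat

theorem Coprime.sum_totient_gcd_div {a b : ℕ} (hab : a.Coprime b) :
    ∑ τ ∈ (a * b).divisors, φ (gcd τ (a * b / τ)) =
      (∑ τ ∈ a.divisors, φ (gcd τ (a / τ))) * ∑ τ ∈ b.divisors, φ (gcd τ (b / τ)) := by
  have key : ∀ x ∈ a.divisors, ∀ y ∈ b.divisors,
      φ (gcd (x * y) (a * b / (x * y))) = φ (gcd x (a / x)) * φ (gcd y (b / y)) := by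
    intro x hx y hy
    obtain ⟨u, rfl⟩ := dvd_of_mem_divisors hx
    obtain ⟨v, rfl⟩ := dvd_of_mem_divisors hy
    have hx0 : 0 < x := pos_of_mem_divisors hx
    have hy0 : 0 < y := pos_of_mem_divisors hy
    have hxy : x.Coprime y := hab.coprime_mul_right.coprime_mul_right_right
    have hxv : x.Coprime v := hab.coprime_mul_right.coprime_mul_left_right
    have huy : u.Coprime y := hab.coprime_mul_left.coprime_mul_right_right
    have huv : u.Coprime v := hab.coprime_mul_left.coprime_mul_left_right
    rw [mul_mul_mul_comm, Nat.mul_div_cancel_left _ (mul_pos hx0 hy0),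
      Nat.mul_div_cancel_left _ hx0, Nat.mul_div_cancel_left _ hy0, huv.gcd_mul,
      huy.symm.gcd_mul_right_cancel, hxv.gcd_mul_left_cancel]
    exact totient_mul (huv.of_dvd (gcd_dvd_right _ _) (gcd_dvd_right _ _))
  rw [_root_.Nat.divisors_mul, Finset.mul_def, Finset.sum_image hab.mul_injOn_divisors,
    Finset.sum_product, Finset.sum_mul_sum]
  exact Finset.sum_congr rfl fun x hx => Finset.sum_congr rfl fun y hy => key x hx y hy

theorem sum_range_totient_prime_pow {p : ℕ} (hp : p.Prime) (m : ℕ) :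
    ∑ i ∈ Finset.range (m + 1), φ (p ^ i) = p ^ m := by
  rw [← sum_divisors_prime_pow hp, sum_totient]

theorem sum_totient_gcd_div_prime_pow_le {p : ℕ} (hp : p.Prime) (n : ℕ) :
    ∑ τ ∈ (p ^ n).divisors, φ (gcd τ (p ^ n / τ)) ≤ 2 * p ^ (n / 2) := by
  let f : ℕ → ℕ := fun i => if i ≤ n / 2 then φ (p ^ i) else 0
  have hf : ∑ i ∈ Finset.range (n + 1), f i = p ^ (n / 2) := by
    rw [← sum_range_totient_prime_pow hp, ← Finset.sum_filter]
    congr 1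
    ext i
    simp only [Finset.mem_filter, Finset.mem_range]
    lia
  rw [sum_divisors_prime_pow hp, two_mul, ← hf]
  nth_rw 3 [← Finset.sum_range_reflect]
  rw [← Finset.sum_add_distrib]
  refine Finset.sum_le_sum fun i hi => ?_
  have hi : i ≤ n := Finset.mem_range_succ_iff.1 hi
  rw [Nat.pow_div hi hp.pos]
  rcases le_total i (n - i) with h | h
  · have h2 : i ≤ n / 2 := by lia
    rw [gcd_eq_left (pow_dvd_pow p h)]
    simp [f, h2]
  · have h2 : n - i ≤ n / 2 := by lia
    rw [gcd_eq_right (pow_dvd_pow p h)]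
    simp [f, h2]

end Nat

/-- The sum of `φ(gcd(τ, N/τ))` over all positive divisors `τ` of `N` is at most
`√N · 2^{ω(N)}`. -/
theorem sum_totient_gcd_le (N : ℕ) (hN : 1 ≤ N) :
    ((∑ τ ∈ N.divisors, Nat.totient (Nat.gcd τ (N / τ)) : ℕ) : ℝ) ≤
      Real.sqrt N * 2 ^ N.primeFactors.card := by
  induction N using Nat.recOnPosPrimePosCoprime with
  | zero => simp at hN
  | one => simp
  | prime_pow p n hp hn =>
    rw [Nat.primeFactors_prime_pow hn.ne' hp, Finset.card_singleton, pow_one, mul_comm]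
    have hle : ((p ^ (n / 2) : ℕ) : ℝ) ≤ √((p ^ n : ℕ) : ℝ) := by
      apply Real.le_sqrt_of_sq_le
      norm_cast
      rw [← pow_mul]
      exact Nat.pow_le_pow_right hp.pos (Nat.div_mul_le_self n 2)
    calc _ ≤ ((2 * p ^ (n / 2) : ℕ) : ℝ) :=
          mod_cast Nat.sum_totient_gcd_div_prime_pow_le hp n
      _ ≤ _ := by rw [Nat.cast_mul, Nat.cast_two]; gcongr
  | coprime a b ha hb hab iha ihb =>
    rw [hab.sum_totient_gcd_div, hab.primeFactors_mul,
      Finset.card_union_of_disjoint hab.disjoint_primeFactors, pow_add]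
    push_cast at *
    rw [Real.sqrt_mul (by positivity), mul_mul_mul_comm]
    exact mul_le_mul (iha (by lia)) (ihb (by lia)) (by positivity) (by positivity)
end

section
/- Let N ≥ 1 have exactly m = ω(N) distinct prime divisors, and let p₁ < p₂ < … denote the primes in increasing order. Then ψ(N)/√N ≥ ∏_{i=1}^{m} (pᵢ + 1)/√pᵢ. -/
/-- `ψ(N) = N · ∏_{p | N} (1 + 1/p)`. -/
noncomputable def psi (N : ℕ) : ℝ := N * ∏ p ∈ N.primeFactors, (1 + 1 / (p : ℝ))

theorem monotoneOn_add_one_div_sqrt :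
    MonotoneOn (fun x : ℝ ↦ (x + 1) / √x) (Set.Ici 1) := by
  intro x hx y _ hxy
  have hx1 : 1 ≤ √x := Real.one_le_sqrt.mpr hx
  have hab : √x ≤ √y := Real.sqrt_le_sqrt hxy
  have hx0 : 0 ≤ x := zero_le_one.trans hx
  have hxs := Real.mul_self_sqrt hx0
  have hys := Real.mul_self_sqrt (hx0.trans hxy)
  show (x + 1) / √x ≤ (y + 1) / √y
  rw [div_le_div_iff₀ (by linarith) (by linarith)]
  generalize √x = a at *
  generalize √y = b at *
  subst hxs hys
  nlinarith [mul_nonneg (sub_nonneg.mpr hab)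
    (sub_nonneg.mpr (one_le_mul_of_one_le_of_one_le hx1 (hx1.trans hab)))]

/-- A monotone product over the first `s.card` numbers satisfying `p` is at most the product over
any finite set `s` of numbers satisfying `p`. -/
theorem prod_range_card_nth_le_prod {p : ℕ → Prop} (hp : {n | p n}.Infinite) {f : ℕ → ℝ}
    (hf : MonotoneOn f {n | p n}) (hf0 : ∀ n, p n → 0 ≤ f n) (s : Finset ℕ)
    (hs : ∀ n ∈ s, p n) :
    ∏ i ∈ Finset.range s.card, f (Nat.nth p i) ≤ ∏ n ∈ s, f n := by
  classical
  induction s using Finset.induction_on_max with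
  | empty => simp
  | insert a s hlt ih =>
    have has : a ∉ s := fun h ↦ (hlt a h).false
    have hpa : p a := hs a (Finset.mem_insert_self a s)
    have hps : ∀ n ∈ s, p n := fun n hn ↦ hs n (Finset.mem_insert_of_mem hn)
    rw [Finset.card_insert_of_notMem has, Finset.prod_range_succ, Finset.prod_insert has, mul_comm]
    have hcard : s.card < Nat.count p (a + 1) := by
      rw [Nat.count_succ_eq_succ_count hpa, Nat.lt_succ_iff, Nat.count_eq_card_filter_range]
      exact Finset.card_le_card fun n hn ↦
        Finset.mem_filter.mpr ⟨Finset.mem_range.mpr (hlt n hn), hps n hn⟩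
    have hnth : Nat.nth p s.card ≤ a := Nat.lt_succ_iff.mp (Nat.nth_lt_of_lt_count hcard)
    exact mul_le_mul (hf (Nat.nth_mem_of_infinite hp _) hpa hnth) (ih hps)
      (Finset.prod_nonneg fun i _ ↦ hf0 _ (Nat.nth_mem_of_infinite hp i)) (hf0 a hpa)

theorem prod_primeFactors_add_one_div_sqrt_le {N : ℕ} (hN : 1 ≤ N) :
    ∏ p ∈ N.primeFactors, ((p : ℝ) + 1) / √(p : ℝ) ≤ psi N / √(N : ℝ) := by
  have hrad : ∏ p ∈ N.primeFactors, √(p : ℝ) ≤ √(N : ℝ) := by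
    rw [← Real.sqrt_prod _ fun p _ ↦ Nat.cast_nonneg p]
    refine Real.sqrt_le_sqrt ?_
    rw [← Nat.cast_prod]
    exact Nat.cast_le.mpr (Nat.le_of_dvd hN (Nat.prod_primeFactors_dvd N))
  have hpsi : psi N / √(N : ℝ) = √(N : ℝ) * ∏ p ∈ N.primeFactors, (1 + 1 / (p : ℝ)) := by
    rw [psi, mul_div_right_comm, Real.div_sqrt]
  have hfactor : ∀ p ∈ N.primeFactors,
      ((p : ℝ) + 1) / √(p : ℝ) = √(p : ℝ) * (1 + 1 / (p : ℝ)) := by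
    intro p hp
    have hp0 : (p : ℝ) ≠ 0 := mod_cast (Nat.prime_of_mem_primeFactors hp).ne_zero
    field_simp
    exact (Real.sq_sqrt (Nat.cast_nonneg p)).symm
  rw [hpsi, Finset.prod_congr rfl hfactor, Finset.prod_mul_distrib]
  exact mul_le_mul_of_nonneg_right hrad (Finset.prod_nonneg fun p _ ↦ by positivity)

/-- If `N` has exactly `m = ω(N)` distinct prime divisors, then
`ψ(N)/√N ≥ ∏_{i=1}^{m} (pᵢ + 1)/√pᵢ`, where `pᵢ` is the `i`-th prime. -/
theorem psi_div_sqrt_ge_prod_first_primes (N : ℕ) (hN : 1 ≤ N) :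
    ∏ i ∈ Finset.range N.primeFactors.card,
        ((Nat.nth Nat.Prime i : ℝ) + 1) / Real.sqrt (Nat.nth Nat.Prime i) ≤
      psi N / Real.sqrt N := by
  have hmono : MonotoneOn (fun n : ℕ ↦ ((n : ℝ) + 1) / √(n : ℝ)) {n | n.Prime} :=
    fun m hm n hn hmn ↦ monotoneOn_add_one_div_sqrt
      (Set.mem_Ici.mpr (Nat.one_le_cast.mpr (Nat.Prime.one_le hm)))
      (Set.mem_Ici.mpr (Nat.one_le_cast.mpr (Nat.Prime.one_le hn)))
      (Nat.cast_le.mpr hmn)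
  exact (prod_range_card_nth_le_prod Nat.infinite_setOfPred_prime hmono (fun n _ ↦ by positivity)
    N.primeFactors fun _ ↦ Nat.prime_of_mem_primeFactors).trans
      (prod_primeFactors_add_one_div_sqrt_le hN)
end

section
/- Let N ≥ 1 have exactly m = ω(N) distinct prime divisors, and let p₁ < p₂ < … denote the primes in increasing order. Then ψ(N) ≥ ∏_{i=1}^{m} (pᵢ + 1). -/
/-- Among the finite sets of given cardinality whose elements satisfy `P`, the initial segment
minimizes the product of the values of a nonnegative monotone function. -/
theorem Finset.prod_range_card_nth_le {P : ℕ → Prop} {f : ℕ → ℝ} (hf : Monotone f)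
    (hf0 : ∀ n, 0 ≤ f n) (s : Finset ℕ) (hs : ∀ n ∈ s, P n) :
    ∏ i ∈ Finset.range s.card, f (Nat.nth P i) ≤ ∏ n ∈ s, f n := by
  classical
  induction s using Finset.induction_on_max with
  | empty => simp
  | insert a s hlt ih =>
    have ha : a ∉ s := fun h => (hlt a h).false
    have hcard : s.card ≤ Nat.count P a := by
      rw [Nat.count_eq_card_filter_range]
      exact Finset.card_le_card fun n hn => Finset.mem_filter.2
        ⟨Finset.mem_range.2 (hlt n hn), hs n (Finset.mem_insert_of_mem hn)⟩
    have hnth : Nat.nth P s.card ≤ a := by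
      refine Nat.le_of_lt_succ (Nat.nth_lt_of_lt_count ?_)
      rw [Nat.count_succ, if_pos (hs a (Finset.mem_insert_self a s))]
      exact Nat.lt_succ_of_le hcard
    rw [Finset.card_insert_of_notMem ha, Finset.prod_range_succ, Finset.prod_insert ha,
      mul_comm (f a)]
    exact mul_le_mul (ih fun n hn => hs n (Finset.mem_insert_of_mem hn)) (hf hnth) (hf0 _)
      (Finset.prod_nonneg fun n _ => hf0 n)

theorem prod_primeFactors_add_one_le_psi {N : ℕ} (hN : N ≠ 0) :
    ∏ p ∈ N.primeFactors, ((p : ℝ) + 1) ≤ psi N := by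
  have hrad : ∏ p ∈ N.primeFactors, (p : ℝ) ≤ N := by
    rw [← Nat.cast_prod]
    exact_mod_cast Nat.le_of_dvd (Nat.pos_of_ne_zero hN) (Nat.prod_primeFactors_dvd N)
  calc ∏ p ∈ N.primeFactors, ((p : ℝ) + 1)
      = ∏ p ∈ N.primeFactors, (p : ℝ) * (1 + 1 / (p : ℝ)) := by
        refine Finset.prod_congr rfl fun p hp => ?_
        have hp0 : (p : ℝ) ≠ 0 := by exact_mod_cast (Nat.prime_of_mem_primeFactors hp).ne_zero
        field_simp
    _ = (∏ p ∈ N.primeFactors, (p : ℝ)) * ∏ p ∈ N.primeFactors, (1 + 1 / (p : ℝ)) :=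
        Finset.prod_mul_distrib
    _ ≤ psi N := mul_le_mul_of_nonneg_right hrad (Finset.prod_nonneg fun p _ => by positivity)

/-- If `N` has exactly `m = ω(N)` distinct prime divisors, then
`ψ(N) ≥ ∏_{i=1}^{m} (pᵢ + 1)`, where `pᵢ` is the `i`-th prime. -/
theorem psi_ge_prod_first_primes (N : ℕ) (hN : 1 ≤ N) :
    ∏ i ∈ Finset.range N.primeFactors.card, ((Nat.nth Nat.Prime i : ℝ) + 1) ≤ psi N :=
  (Finset.prod_range_card_nth_le (f := fun n => (n : ℝ) + 1)
    (fun a b h => by simpa using h) (fun n => by positivity) N.primeFactors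
    fun _ => Nat.prime_of_mem_primeFactors).trans
    (prod_primeFactors_add_one_le_psi (Nat.one_le_iff_ne_zero.1 hN))
end
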